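/- Let (M, φ) be a size pair with φ : M → ℝ real-valued. Each discontinuity point (x̄, ȳ) (with x̄ < ȳ) of the size function ℓ_{(M,φ)} is such that either x̄ is a discontinuity point of the one-variable function x ↦ ℓ_{(M,φ)}(x, ȳ), or ȳ is a discontinuity point of the one-variable function y ↦ ℓ_{(M,φ)}(x̄, y), or both these conditions hold. -/

import Mathlib

open scoped ENNReal Manifold
open Filter

noncomputable section

namespace SizeTheory

/-- The 1-dimensional size function of the size pair `(M, φ)`: the number of connected
components of the sublevel set `{φ ≤ t}` containing at least one point of `{φ ≤ s}`. -/
def size1 {M : Type*} [TopologicalSpace M] (φ : M → ℝ) (s t : ℝ) : ℕ :=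
  {S : Set M | ∃ P : M, φ P ≤ s ∧ S = connectedComponentIn {Q : M | φ Q ≤ t} P}.ncard

/-- The k-dimensional size function of the size pair `(M, φ)`: the number of connected
components of `M⟨φ ⪯ y⟩` containing at least one point of `M⟨φ ⪯ x⟩`. -/
def sizek {M : Type*} [TopologicalSpace M] {k : ℕ} (φ : M → Fin k → ℝ)
    (x y : Fin k → ℝ) : ℕ :=
  {S : Set M | ∃ P : M, (∀ i, φ P i ≤ x i) ∧
    S = connectedComponentIn {Q : M | ∀ i, φ Q i ≤ y i} P}.ncard

/-- Multiplicity of a (candidate) proper cornerpoint `(x, y)` of a 1-dimensional size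
function `ℓ`. -/
def mult (ℓ : ℝ → ℝ → ℕ) (x y : ℝ) : ℤ :=
  sInf {v : ℤ | ∃ ε : ℝ, 0 < ε ∧ x + ε < y - ε ∧
    v = (ℓ (x + ε) (y - ε) : ℤ) - (ℓ (x - ε) (y - ε) : ℤ)
      - (ℓ (x + ε) (y + ε) : ℤ) + (ℓ (x - ε) (y + ε) : ℤ)}

/-- Multiplicity of a (candidate) cornerpoint at infinity `(a, ∞)` of a 1-dimensional size
function `ℓ`. -/
def multInf (ℓ : ℝ → ℝ → ℕ) (a : ℝ) : ℤ :=
  sInf {v : ℤ | ∃ ε : ℝ, 0 < ε ∧ a + ε < 1 / ε ∧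
    v = (ℓ (a + ε) (1 / ε) : ℤ) - (ℓ (a - ε) (1 / ε) : ℤ)}

/-- `(x, y)` is a proper cornerpoint of the 1-dimensional size function `ℓ`. -/
def IsProperCornerpoint (ℓ : ℝ → ℝ → ℕ) (x y : ℝ) : Prop :=
  x < y ∧ 0 < mult ℓ x y

/-- `(a, ∞)` is a cornerpoint at infinity (cornerline) of the 1-dimensional size
function `ℓ`. -/
def IsCornerpointAtInfinity (ℓ : ℝ → ℝ → ℕ) (a : ℝ) : Prop :=
  0 < multInf ℓ a

/-- The cost `(y - x)/2` of moving a point of `Δ̄*` (points `(x, y)` with `y` possibly `∞`)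
onto the diagonal. -/
def diagHalf (p : ℝ × WithTop ℝ) : ℝ≥0∞ :=
  WithTop.recTopCoe ⊤ (fun y => ENNReal.ofReal ((y - p.1) / 2)) p.2

/-- `|y - y'|` for ordinates in `ℝ ∪ {∞}`, with the conventions `∞ - y = y - ∞ = ∞`
for `y ≠ ∞` and `∞ - ∞ = 0`. -/
def yDist (y y' : WithTop ℝ) : ℝ≥0∞ :=
  WithTop.recTopCoe (WithTop.recTopCoe 0 (fun _ => (⊤ : ℝ≥0∞)) y')
    (fun a => WithTop.recTopCoe ⊤ (fun b => ENNReal.ofReal |a - b|) y') y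

/-- The pseudometric `δ` used in the definition of the matching distance. -/
def deltaCP (p q : ℝ × WithTop ℝ) : ℝ≥0∞ :=
  min (max (ENNReal.ofReal |p.1 - q.1|) (yDist p.2 q.2)) (max (diagHalf p) (diagHalf q))

/-- The multiplicity, in the augmented multiset of cornerpoints of the 1-dimensional size
function `ℓ`, of a point `p` of `Δ̄*`: cornerpoints (proper or at infinity) are counted
with their multiplicities, and the points of the diagonal with infinite multiplicity. -/
def cpMult (ℓ : ℝ → ℝ → ℕ) (p : ℝ × WithTop ℝ) : ℕ∞ :=
  WithTop.recTopCoe ((multInf ℓ p.1).toNat : ℕ∞)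
    (fun y => if p.1 = y then (⊤ : ℕ∞)
      else if p.1 < y then ((mult ℓ p.1 y).toNat : ℕ∞) else 0) p.2

/-- The underlying "index type" of a multiset of points of `Δ̄*` described by the
multiplicity function `m`: each point `p` appears with multiplicity `m p`. -/
def CPIdx (m : ℝ × WithTop ℝ → ℕ∞) : Type :=
  Σ p : ℝ × WithTop ℝ, {n : ℕ // (n : ℕ∞) < m p}

/-- The matching distance between two 1-dimensional size functions: the infimum, over all
bijections `σ` between the two augmented multisets of cornerpoints, of the supremum of
`δ(P, σ(P))`. -/
def dMatch (ℓ₁ ℓ₂ : ℝ → ℝ → ℕ) : ℝ≥0∞ :=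
  ⨅ σ : CPIdx (cpMult ℓ₁) ≃ CPIdx (cpMult ℓ₂),
    ⨆ a : CPIdx (cpMult ℓ₁), deltaCP a.1 ((σ a).1)

/-- `(l, b)` is an admissible pair: `l` is a unit vector (Euclidean norm) with strictly
positive components, and the components of `b` sum to zero. -/
def Admissible {k : ℕ} (l b : Fin k → ℝ) : Prop :=
  Real.sqrt (∑ i, l i ^ 2) = 1 ∧ (∀ i, 0 < l i) ∧ ∑ i, b i = 0

/-- The 1-dimensional measuring function `F_{(l,b)}^φ (P) = max_i (φ_i(P) - b_i)/l_i`
corresponding to the half-plane `π_{(l,b)}`. -/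
def Fpair {M : Type*} {k : ℕ} (φ : M → Fin k → ℝ) (l b : Fin k → ℝ) (P : M) : ℝ :=
  ⨆ i, (φ P i - b i) / l i

section ManifoldDefs

variable {E : Type*} [NormedAddCommGroup E] [InnerProductSpace ℝ E] [FiniteDimensional ℝ E]
  {H : Type*} [TopologicalSpace H] (I : ModelWithCorners ℝ E H)
  {M : Type*} [TopologicalSpace M] [ChartedSpace H M]

/-- The differential (gradient, up to the Riemannian identification) at `Q` of the `i`-th
component of `φ : M → ℝ^k`, seen as a covector at `Q`. -/
def dcomp {k : ℕ} (φ : M → Fin k → ℝ) (Q : M) (i : Fin k) :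
    TangentSpace I Q →L[ℝ] ℝ :=
  mfderiv I 𝓘(ℝ, ℝ) (fun P => φ P i) Q

/-- `Q` is an `(l, b)`-pseudocritical point for `φ`: the convex hull of the differentials
`dφ_i(Q)`, for the indices `i ∈ I_Q` realizing the maximum defining `F_{(l,b)}^φ (Q)`,
contains the null (co)vector. -/
def LBPseudocritPt {k : ℕ} (l b : Fin k → ℝ) (φ : M → Fin k → ℝ) (Q : M) : Prop :=
  ∃ lam : Fin k → ℝ, (∀ i, 0 ≤ lam i) ∧ (∀ i, lam i ≤ 1) ∧
    (∀ i, lam i ≠ 0 → (φ Q i - b i) / l i = Fpair φ l b Q) ∧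
    (∑ i, lam i) = 1 ∧ (∑ i, lam i • dcomp I φ Q i) = 0

/-- `c` is an `(l, b)`-pseudocritical value for `φ`. -/
def LBPseudocritVal {k : ℕ} (l b : Fin k → ℝ) (φ : M → Fin k → ℝ) (c : ℝ) : Prop :=
  ∃ Q : M, Fpair φ l b Q = c ∧ LBPseudocritPt I l b φ Q

/-- `ξ : M → ℝ^h` is `C¹` at the point `Q`. -/
def C1At {h : ℕ} (ξ : M → Fin h → ℝ) (Q : M) : Prop :=
  ∀ j, ContMDiffAt I 𝓘(ℝ, ℝ) 1 (fun P => ξ P j) Q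

/-- `Q` is a pseudocritical point for `ξ : M → ℝ^h`: `ξ` is `C¹` at `Q` and the convex hull
of the differentials `dξ_1(Q), …, dξ_h(Q)` contains the null (co)vector. -/
def PseudocritPt {h : ℕ} (ξ : M → Fin h → ℝ) (Q : M) : Prop :=
  C1At I ξ Q ∧
  ∃ lam : Fin h → ℝ, (∀ j, 0 ≤ lam j) ∧ (∀ j, lam j ≤ 1) ∧
    (∑ j, lam j) = 1 ∧ (∑ j, lam j • dcomp I ξ Q j) = 0

/-- `v` is a pseudocritical value for `ξ`. -/
def PseudocritVal {h : ℕ} (ξ : M → Fin h → ℝ) (v : Fin h → ℝ) : Prop :=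
  ∃ Q : M, ξ Q = v ∧ PseudocritPt I ξ Q

/-- `v` is a special value for `ξ`: `v` is the image of a point at which `ξ` is not `C¹`. -/
def SpecialVal {h : ℕ} (ξ : M → Fin h → ℝ) (v : Fin h → ℝ) : Prop :=
  ∃ Q : M, ξ Q = v ∧ ¬ C1At I ξ Q

end ManifoldDefs

/-- The components of `{φ ≤ t}` counted by `size1 φ s t`, as an image. -/
def sublevelComponents {M : Type*} [TopologicalSpace M] (φ : M → ℝ) (s t : ℝ) : Set (Set M) :=
  (fun P => connectedComponentIn {Q : M | φ Q ≤ t} P) '' {P : M | φ P ≤ s}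

theorem size1_eq_ncard {M : Type*} [TopologicalSpace M] (φ : M → ℝ) (s t : ℝ) :
    size1 φ s t = (sublevelComponents φ s t).ncard := by
  unfold size1 sublevelComponents
  congr 1
  ext S
  simp [eq_comm]

theorem connectedComponentIn_sublevel_mem_nhds {M : Type*} [TopologicalSpace M]
    [LocallyConnectedSpace M] {φ : M → ℝ} (hφ : Continuous φ) {t : ℝ} {P : M} (hP : φ P < t) :
    connectedComponentIn {Q : M | φ Q ≤ t} P ∈ nhds P :=
  connectedComponentIn_mem_nhds <| mem_of_superset
    ((isOpen_lt hφ continuous_const).mem_nhds hP) fun _ hQ => show _ ≤ t from le_of_lt hQ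

theorem sublevelComponents_finite {M : Type*} [TopologicalSpace M] [CompactSpace M]
    [LocallyConnectedSpace M] {φ : M → ℝ} (hφ : Continuous φ) {s t : ℝ} (hst : s < t) :
    (sublevelComponents φ s t).Finite := by
  have hK : IsCompact {P : M | φ P ≤ s} := (isClosed_le hφ continuous_const).isCompact
  obtain ⟨F, -, hF⟩ := hK.elim_nhds_subcover (connectedComponentIn {Q : M | φ Q ≤ t})
    fun P hP => connectedComponentIn_sublevel_mem_nhds hφ (lt_of_le_of_lt hP hst)
  refine (F.finite_toSet.image (connectedComponentIn {Q : M | φ Q ≤ t})).subset ?_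
  rintro _ ⟨P, hP, rfl⟩
  obtain ⟨R, hR, hPR⟩ := Set.mem_iUnion₂.1 (hF hP)
  exact ⟨R, hR, connectedComponentIn_eq hPR⟩

theorem sublevelComponents_mono {M : Type*} [TopologicalSpace M] (φ : M → ℝ) {s s' : ℝ}
    (t : ℝ) (h : s ≤ s') : sublevelComponents φ s t ⊆ sublevelComponents φ s' t :=
  Set.image_mono fun _ hP => le_trans hP h

/-- Sending each component of `{φ ≤ t}` to the component of `{φ ≤ t'}` containing it. -/
theorem image_sublevelComponents {M : Type*} [TopologicalSpace M] (φ : M → ℝ) {s t t' : ℝ}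
    (hst : s ≤ t) (htt' : t ≤ t') :
    (fun S : Set M => ⋃ P ∈ S, connectedComponentIn {Q : M | φ Q ≤ t'} P) ''
      sublevelComponents φ s t = sublevelComponents φ s t' := by
  unfold sublevelComponents
  rw [Set.image_image]
  refine Set.image_congr fun P hP => ?_
  have hP' : P ∈ {Q : M | φ Q ≤ t} := le_trans hP hst
  refine Set.Subset.antisymm (Set.iUnion₂_subset fun R hR => ?_)
    (Set.subset_biUnion_of_mem (mem_connectedComponentIn hP'))
  have hsub : {Q : M | φ Q ≤ t} ⊆ {Q : M | φ Q ≤ t'} := fun _ hQ => le_trans hQ htt'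
  exact (connectedComponentIn_eq (connectedComponentIn_mono P hsub hR)).ge

section Monotonicity

variable {M : Type*} [TopologicalSpace M] [CompactSpace M] [LocallyConnectedSpace M] {φ : M → ℝ}

theorem size1_mono_left (hφ : Continuous φ) {s s' t : ℝ} (h : s ≤ s') (ht : s' < t) :
    size1 φ s t ≤ size1 φ s' t := by
  simp only [size1_eq_ncard]
  exact Set.ncard_le_ncard (sublevelComponents_mono φ t h) (sublevelComponents_finite hφ ht)

theorem size1_anti_right (hφ : Continuous φ) {s t t' : ℝ} (hst : s < t) (h : t ≤ t') :
    size1 φ s t' ≤ size1 φ s t := by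
  simp only [size1_eq_ncard]
  rw [← image_sublevelComponents φ hst.le h]
  exact Set.ncard_image_le (sublevelComponents_finite hφ hst)

/-- The horizontal increments of a size function do not increase with the ordinate. -/
theorem size1_add_le_add (hφ : Continuous φ) {s s' t t' : ℝ} (hs : s ≤ s') (hst : s' < t)
    (ht : t ≤ t') : size1 φ s' t' + size1 φ s t ≤ size1 φ s' t + size1 φ s t' := by
  have hfin := sublevelComponents_finite hφ hst
  have h₁ := Set.ncard_sdiff_add_ncard_of_subset (sublevelComponents_mono φ t hs) hfin
  have h₂ := Set.ncard_sdiff_add_ncard_of_subset (sublevelComponents_mono φ t' hs)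
    (sublevelComponents_finite hφ (hst.trans_le ht))
  have hdiff (f : Set M → Set M) (A B : Set (Set M)) : f '' A \ f '' B ⊆ f '' (A \ B) := by
    rintro _ ⟨⟨S, hS, rfl⟩, hB⟩
    exact ⟨S, ⟨hS, fun h => hB ⟨S, h, rfl⟩⟩, rfl⟩
  have h₃ : (sublevelComponents φ s' t' \ sublevelComponents φ s t').ncard ≤
      (sublevelComponents φ s' t \ sublevelComponents φ s t).ncard := by
    rw [← image_sublevelComponents φ hst.le ht,
      ← image_sublevelComponents φ (hs.trans hst.le) ht]
    exact (Set.ncard_le_ncard (hdiff _ _ _) (hfin.sdiff.image _)).trans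
      (Set.ncard_image_le hfin.sdiff)
  simp only [size1_eq_ncard]
  omega

/-- A size function is right-continuous in its first variable. -/
theorem exists_size1_eq_right (hφ : Continuous φ) {s t : ℝ} (hst : s < t) :
    ∃ s' > s, ∀ x, s ≤ x → x < s' → size1 φ x t = size1 φ s t := by
  set U : Set M := ⋃ P ∈ {P : M | φ P ≤ s}, connectedComponentIn {Q : M | φ Q ≤ t} P
  have hsub : {P : M | φ P ≤ s} ⊆ interior U := fun P hP =>
    mem_interior_iff_mem_nhds.2 <| mem_of_superset
      (connectedComponentIn_sublevel_mem_nhds hφ (lt_of_le_of_lt hP hst))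
      (Set.subset_biUnion_of_mem (u := connectedComponentIn {Q : M | φ Q ≤ t}) hP)
  obtain ⟨s', hs', hmem⟩ : ∃ s' > s, ∀ Q, φ Q < s' → Q ∈ U := by
    rcases (interior U)ᶜ.eq_empty_or_nonempty with he | hne
    · exact ⟨s + 1, by linarith, fun Q _ =>
        interior_subset (Set.compl_empty_iff.1 he ▸ Set.mem_univ Q)⟩
    · obtain ⟨R, hR, hmin⟩ := isOpen_interior.isClosed_compl.isCompact.exists_isMinOn hne
        hφ.continuousOn
      refine ⟨φ R, lt_of_not_ge fun h => hR (hsub h), fun Q hQ => ?_⟩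
      by_contra hQU
      exact absurd (hmin fun h => hQU (interior_subset h)) (not_le.2 hQ)
  refine ⟨s', hs', fun x hsx hx => ?_⟩
  simp only [size1_eq_ncard]
  congr 1
  refine Set.Subset.antisymm ?_ (sublevelComponents_mono φ t hsx)
  rintro _ ⟨Q, hQ, rfl⟩
  obtain ⟨P, hP, hQP⟩ := Set.mem_iUnion₂.1 (hmem Q (lt_of_le_of_lt hQ hx))
  exact ⟨P, hP, connectedComponentIn_eq hQP⟩

end Monotonicity

theorem exists_forall_eq_of_continuousAt_natCast {f : ℝ → ℕ} {a : ℝ}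
    (hf : ContinuousAt (fun x => (f x : ℝ)) a) : ∃ ε > 0, ∀ x, |x - a| < ε → f x = f a := by
  obtain ⟨ε, hε, h⟩ := Metric.continuousAt_iff.1 hf 1 one_pos
  refine ⟨ε, hε, fun x hx => ?_⟩
  have hd := h (by rwa [Real.dist_eq])
  rw [Nat.dist_cast_real] at hd
  exact of_not_not fun hne => (Nat.pairwise_one_le_dist hne).not_gt hd

/-- Each discontinuity point `(xbar, ybar)` of a 1-dimensional size function is such that either
`xbar` is a discontinuity point of `ℓ(·, ybar)`, or `ybar` is a discontinuity point of `ℓ(xbar, ·)`,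
or both. -/
theorem discontinuity_one_dim {M : Type*} [TopologicalSpace M] [Nonempty M]
    [CompactSpace M] [LocallyConnectedSpace M] [T2Space M]
    (φ : M → ℝ) (hφ : Continuous φ) (xbar ybar : ℝ) (hxy : xbar < ybar)
    (hd : ¬ ContinuousAt (fun p : ℝ × ℝ => (size1 φ p.1 p.2 : ℝ)) (xbar, ybar)) :
    (¬ ContinuousAt (fun x : ℝ => (size1 φ x ybar : ℝ)) xbar) ∨
    (¬ ContinuousAt (fun y : ℝ => (size1 φ xbar y : ℝ)) ybar) := by
  by_contra! hc
  obtain ⟨hx, hy⟩ := hc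
  obtain ⟨ε, hε, hx⟩ := exists_forall_eq_of_continuousAt_natCast hx
  obtain ⟨η, hη, hy⟩ := exists_forall_eq_of_continuousAt_natCast hy
  obtain ⟨y₀, hy₀, hy₀'⟩ := exists_between (max_lt hxy (sub_lt_self ybar hη))
  obtain ⟨hxy₀, hηy₀⟩ := max_lt_iff.1 hy₀
  obtain ⟨s, hs, hright⟩ := exists_size1_eq_right hφ hxy₀
  have hnhds : Set.Ioo (xbar - ε) (min s y₀) ×ˢ Set.Ioo y₀ (ybar + η) ∈ nhds (xbar, ybar) :=
    prod_mem_nhds (Ioo_mem_nhds (by linarith) (lt_min hs hxy₀)) (Ioo_mem_nhds hy₀' (by linarith))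
  refine hd (continuousAt_const.congr (f := fun _ => (size1 φ xbar ybar : ℝ)) ?_)
  filter_upwards [hnhds]
  rintro ⟨x, y⟩ ⟨⟨hx₁, hx₂⟩, hy₁, hy₂⟩
  dsimp only at hx₁ hx₂ hy₁ hy₂ ⊢
  obtain ⟨hxs, hxy'⟩ := lt_min_iff.1 hx₂
  have hvert : size1 φ xbar y = size1 φ xbar ybar :=
    hy y (abs_lt.2 ⟨by linarith, by linarith⟩)
  norm_cast
  rcases le_total xbar x with h | h
  · have h₁ := size1_add_le_add hφ h hxy' hy₁.le
    have h₂ := hright x h hxs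
    have h₃ := size1_mono_left hφ h (hxy'.trans hy₁)
    omega
  · have hhor : size1 φ x ybar = size1 φ xbar ybar :=
      hx x (abs_lt.2 ⟨by linarith, by linarith⟩)
    have h₁ := size1_mono_left hφ h (hxy₀.trans hy₁)
    rcases le_total ybar y with h' | h'
    · have h₂ := size1_add_le_add hφ h hxy h'
      omega
    · have h₂ := size1_anti_right hφ (hxy'.trans hy₁) h'
      omega

end SizeTheory
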